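/- Let A = (a₁,…,a_m) with each a_j ≥ 2 and let b ≥ 0 be an integer with m + b ≥ 1; set |A| = a₁ + … + a_m and i = |A| − m + b. Let Q be the quotient of the chain complex of the simplex on the vertex set V = E₁ ⊔ … ⊔ E_m ⊔ B (where |B| = b) by the span of the faces S ⊆ V such that either, for some j, the graph on N_j with edge set S ∩ E_j is not connected, or some element of B does not belong to S. Then the homology of Q vanishes in every degree other than i − 1, and in degree i − 1 it is a free abelian group of rank (a₁−1)!·(a₂−1)!·…·(a_m−1)!. -/

import Mathlib

set_option autoImplicit false

/-!
Statement 3: For A = (a₁,…,a_m), a_j ≥ 2, and b ≥ 0 with m + b ≥ 1, the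
quotient of the chain complex of the simplex on E₁ ⊔ … ⊔ E_m ⊔ B by the span
of the faces in which some graph is not connected or some point of B is
missing, has homology concentrated in degree i − 1 (i = |A| − m + b), where it
is free abelian of rank (a₁−1)!⋯(a_m−1)!.
-/

noncomputable section

open Finset

/-- Generators of degree `d` of the simplicial chain complex on the vertex set `V`:
`(d+1)`-element subsets of `V`. -/
abbrev Gen (V : Type) (d : ℕ) : Type := {S : Finset V // S.card = d + 1}

/-- The degree-`d` chain group: the free abelian group on the `(d+1)`-element
subsets of `V`. -/
abbrev Chain (V : Type) (d : ℕ) : Type := Gen V d →₀ ℤ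

/-- The simplicial boundary operator: `∂S = Σ_m (−1)^{m−1} (S − s_m)`, where
`s₁ < s₂ < …` are the elements of `S` (the sign of the summand removing `s`
is `(−1)` to the number of elements of `S` smaller than `s`).  In degree `0`
it is the zero map. -/
def bdry (V : Type) [LinearOrder V] (d : ℕ) :
    Chain V d →ₗ[ℤ] Chain V (d - 1) := by
  classical
  exact Finsupp.lift (Chain V (d - 1)) ℤ (Gen V d) fun S =>
    ∑ s ∈ S.1, ((-1 : ℤ) ^ (S.1.filter fun t => t < s).card) •
      (if h : (S.1.erase s).card = (d - 1) + 1
        then Finsupp.single (⟨S.1.erase s, h⟩ : Gen V (d - 1)) (1 : ℤ) else 0)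

/-- The subgroup of degree-`d` chains spanned by the "bad" faces, i.e. those not
satisfying the predicate `good`.  The quotient complex is the quotient of the
chain complex of the simplex by these subgroups. -/
def badChains (V : Type) (good : Finset V → Prop) (d : ℕ) : Submodule ℤ (Chain V d) :=
  Submodule.span ℤ {x | ∃ S : Gen V d, ¬ good S.1 ∧ x = Finsupp.single S 1}

/-- Cycles of degree `d` of the quotient complex: chains whose boundary vanishes
in the quotient, i.e. lies in the span of the bad faces. -/
def cycles (V : Type) [LinearOrder V] (good : Finset V → Prop) (d : ℕ) :
    Submodule ℤ (Chain V d) :=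
  Submodule.comap (bdry V d) (badChains V good (d - 1))

/-- The degree-`d` homology of the quotient complex: cycles modulo
(bad chains + boundaries). -/
abbrev homology (V : Type) [LinearOrder V] (good : Finset V → Prop) (d : ℕ) : Type :=
  (cycles V good d) ⧸ (Submodule.comap (cycles V good d).subtype
    (badChains V good d ⊔ LinearMap.range (bdry V (d + 1))))

/-- Edges of the complete graph on `Fin k`: unordered pairs of distinct nodes,
encoded as ordered pairs `(a, b)` with `a < b`. -/
abbrev Edge (k : ℕ) : Type := {p : Fin k × Fin k // p.1 < p.2}

/-- The lexicographic order on edges induced by the order of the nodes. -/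
instance (k : ℕ) : LinearOrder (Edge k) :=
  LinearOrder.lift' (fun e => toLex e.1) fun a b h => Subtype.ext (toLex.injective h)

/-- The graph on the `k` nodes `Fin k` with the given edge set. -/
def graphOf (k : ℕ) (S : Finset (Edge k)) : SimpleGraph (Fin k) :=
  SimpleGraph.fromEdgeSet {q | ∃ p ∈ S, q = s(p.1.1, p.1.2)}


/-- The vertex set of the simplex: the disjoint union `E₁ ⊔ … ⊔ E_m ⊔ B`,
where `E_j` is the set of all unordered pairs of distinct nodes of the `j`-th
node set `N_j = Fin (A j)`, and `B` is a `b`-element set. -/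
abbrev Vtx (m : ℕ) (A : Fin m → ℕ) (b : ℕ) : Type :=
  (Σ j : Fin m, Edge (A j)) ⊕ Fin b

/-- A face `S` is good iff for every `j` the graph on `N_j` with edge set
`S ∩ E_j` is connected, and every element of `B` belongs to `S`. -/
def goodConn (m : ℕ) (A : Fin m → ℕ) (b : ℕ) (S : Finset (Vtx m A b)) : Prop :=
  (∀ j : Fin m,
    (SimpleGraph.fromEdgeSet
      {q : Sym2 (Fin (A j)) |
        ∃ e : Edge (A j), (Sum.inl ⟨j, e⟩ : Vtx m A b) ∈ S ∧ q = s(e.1.1, e.1.2)}).Connected) ∧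
  ∀ i : Fin b, (Sum.inr i : Vtx m A b) ∈ S

section ConvexFamilies

variable {V : Type}

/-- Chains, viewed as integer functions on all finite sets, that are supported on the members
of the family `F` having `n` elements. -/
def chainsOn (F : Set (Finset V)) (n : ℤ) : Submodule ℤ (Finset V → ℤ) where
  carrier := {x | ∀ S, x S ≠ 0 → S ∈ F ∧ (S.card : ℤ) = n}
  zero_mem' := by
    intro S hS
    exact absurd rfl hS
  add_mem' := by
    intro x y hx hy S hS
    by_cases h : x S = 0
    · refine hy S fun h' => hS ?_
      simp [h, h']
    · exact hx S h
  smul_mem' := by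
    intro c x hx S hS
    refine hx S fun h => hS ?_
    simp [h]

open Classical in
/-- Restriction of a chain to the members of the family `F`. -/
def trunc (F : Set (Finset V)) : (Finset V → ℤ) →ₗ[ℤ] (Finset V → ℤ) where
  toFun x S := if S ∈ F then x S else 0
  map_add' x y := by
    funext S
    simp only [Pi.add_apply]
    split_ifs <;> simp
  map_smul' c x := by
    funext S
    simp

lemma trunc_apply_of_mem {F : Set (Finset V)} {S : Finset V} (h : S ∈ F) (x : Finset V → ℤ) :
    trunc F x S = x S := if_pos h

lemma trunc_apply_of_notMem {F : Set (Finset V)} {S : Finset V} (h : S ∉ F)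
    (x : Finset V → ℤ) : trunc F x S = 0 := if_neg h

lemma apply_eq_zero_of_notMem {F : Set (Finset V)} {n : ℤ} {x : Finset V → ℤ}
    (hx : x ∈ chainsOn F n) {S : Finset V} (h : S ∉ F) : x S = 0 := by
  by_contra h'
  exact h (hx S h').1

lemma chainsOn_mono {F G : Set (Finset V)} (h : F ⊆ G) (n : ℤ) :
    chainsOn F n ≤ chainsOn G n :=
  fun _ hx S hS => ⟨h (hx S hS).1, (hx S hS).2⟩

lemma trunc_mem_chainsOn {F G : Set (Finset V)} {n : ℤ} {x : Finset V → ℤ}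
    (hx : x ∈ chainsOn F n) : trunc G x ∈ chainsOn G n := by
  intro S hS
  by_cases h : S ∈ G
  · rw [trunc_apply_of_mem h] at hS
    exact ⟨h, (hx S hS).2⟩
  · exact absurd (trunc_apply_of_notMem h x) hS

lemma trunc_eq_self {F : Set (Finset V)} {n : ℤ} {x : Finset V → ℤ}
    (hx : x ∈ chainsOn F n) : trunc F x = x := by
  funext S
  by_cases hS : S ∈ F
  · exact trunc_apply_of_mem hS x
  · rw [trunc_apply_of_notMem hS, apply_eq_zero_of_notMem hx hS]

/-- The family `F` is the disjoint union of `F₀` and `F₁`, and no member of `F₁` is contained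
in a member of `F₀`, so that `F₀` spans a subcomplex with quotient spanned by `F₁`. -/
structure SplitFamily (F F₀ F₁ : Set (Finset V)) : Prop where
  mem_iff : ∀ S, S ∈ F ↔ S ∈ F₀ ∨ S ∈ F₁
  disjoint : ∀ S ∈ F₀, S ∉ F₁
  not_subset : ∀ S ∈ F₁, ∀ T ∈ F₀, ¬S ⊆ T

namespace SplitFamily

variable {F F₀ F₁ : Set (Finset V)}

lemma le₀ (h : SplitFamily F F₀ F₁) (n : ℤ) : chainsOn F₀ n ≤ chainsOn F n :=
  chainsOn_mono (fun S hS => (h.mem_iff S).2 (Or.inl hS)) n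

lemma le₁ (h : SplitFamily F F₀ F₁) (n : ℤ) : chainsOn F₁ n ≤ chainsOn F n :=
  chainsOn_mono (fun S hS => (h.mem_iff S).2 (Or.inr hS)) n

lemma mem_chainsOn₀ (h : SplitFamily F F₀ F₁) {n : ℤ} {x : Finset V → ℤ}
    (hx : x ∈ chainsOn F n) (h0 : trunc F₁ x = 0) : x ∈ chainsOn F₀ n := by
  intro S hS
  obtain ⟨h1, h2⟩ := hx S hS
  refine ⟨((h.mem_iff S).1 h1).resolve_right fun h3 => hS ?_, h2⟩
  rw [← trunc_apply_of_mem h3 x, h0, Pi.zero_apply]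

lemma trunc_eq_zero (h : SplitFamily F F₀ F₁) {n : ℤ} {x : Finset V → ℤ}
    (hx : x ∈ chainsOn F₀ n) : trunc F₁ x = 0 := by
  funext S
  by_cases hS : S ∈ F₁
  · rw [trunc_apply_of_mem hS]
    exact apply_eq_zero_of_notMem hx fun h' => h.disjoint S h' hS
  · exact trunc_apply_of_notMem hS x

end SplitFamily

lemma splitFamily_mem (F : Set (Finset V)) (e : V) :
    SplitFamily F {S ∈ F | e ∉ S} {S ∈ F | e ∈ S} where
  mem_iff S := by
    simp only [Set.mem_ofPred_eq]
    tauto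
  disjoint S hS hS' := hS.2 hS'.2
  not_subset _ hS _ hT hST := hT.2 (hST hS.2)

variable [LinearOrder V]

/-- The sign with which `S` occurs in the boundary of `insert s S`, for `s ∉ S`. -/
def incSign (s : V) (S : Finset V) : ℤ := (-1) ^ (S.filter fun t => t < s).card

lemma incSign_mul_self (s : V) (S : Finset V) : incSign s S * incSign s S = 1 := by
  unfold incSign
  rw [← mul_pow]
  simp

lemma incSign_insert (s t : V) (S : Finset V) (ht : t ∉ S) :
    incSign s (insert t S) = if t < s then -incSign s S else incSign s S := by
  unfold incSign
  rw [Finset.filter_insert]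
  split_ifs with h
  · rw [Finset.card_insert_of_notMem (by simp [ht]), pow_succ]
    ring
  · rfl

lemma incSign_swap {s t : V} {S : Finset V} (hs : s ∉ S) (ht : t ∉ S) (hst : s ≠ t) :
    incSign s S * incSign t (insert s S) = -(incSign t S * incSign s (insert t S)) := by
  rw [incSign_insert _ _ _ hs, incSign_insert _ _ _ ht]
  rcases lt_or_gt_of_ne hst with h | h
  · rw [if_pos h, if_neg h.not_gt]
    ring
  · rw [if_pos h, if_neg h.not_gt]
    ring

variable [Fintype V]

/-- The augmented simplicial boundary operator on chains viewed as integer functions. -/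
def del : (Finset V → ℤ) →ₗ[ℤ] (Finset V → ℤ) where
  toFun x S := ∑ s, if s ∈ S then 0 else incSign s S * x (insert s S)
  map_add' x y := by
    funext S
    simp only [Pi.add_apply, ← Finset.sum_add_distrib]
    refine Finset.sum_congr rfl fun s _ => ?_
    split_ifs <;> ring
  map_smul' c x := by
    funext S
    simp only [Pi.smul_apply, smul_eq_mul, Finset.mul_sum, RingHom.id_apply]
    refine Finset.sum_congr rfl fun s _ => ?_
    split_ifs <;> ring

lemma del_apply (x : Finset V → ℤ) (S : Finset V) :
    del x S = ∑ s, if s ∈ S then 0 else incSign s S * x (insert s S) := rfl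

lemma del_del (x : Finset V → ℤ) : del (del x) = 0 := by
  funext S
  let f : V → V → ℤ := fun s t =>
    if s ∈ S ∨ t ∈ S ∨ s = t then 0
    else incSign s S * incSign t (insert s S) * x (insert t (insert s S))
  have hf : ∀ s t, f s t = -f t s := by
    intro s t
    by_cases h : s ∈ S ∨ t ∈ S ∨ s = t
    · have h' : t ∈ S ∨ s ∈ S ∨ t = s := by tauto
      simp only [f, if_pos h, if_pos h', neg_zero]
    · have h' : ¬(t ∈ S ∨ s ∈ S ∨ t = s) := by tauto
      simp only [f, if_neg h, if_neg h']
      push Not at h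
      rw [incSign_swap h.1 h.2.1 h.2.2, Finset.insert_comm]
      ring
  have hsum : del (del x) S = ∑ s, ∑ t, f s t := by
    rw [del_apply]
    refine Finset.sum_congr rfl fun s _ => ?_
    by_cases hs : s ∈ S
    · simp [f, hs]
    · rw [if_neg hs, del_apply, Finset.mul_sum]
      refine Finset.sum_congr rfl fun t _ => ?_
      by_cases ht : t ∈ insert s S
      · have : s ∈ S ∨ t ∈ S ∨ s = t := by
          rw [Finset.mem_insert] at ht
          tauto
        simp only [f, if_pos ht, if_pos this, mul_zero]
      · have : ¬(s ∈ S ∨ t ∈ S ∨ s = t) := by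
          rw [Finset.mem_insert] at ht
          tauto
        simp only [f, if_neg ht, if_neg this, mul_assoc]
  have hneg : ∑ s, ∑ t, f s t = -∑ s, ∑ t, f s t := by
    conv_lhs => rw [Finset.sum_comm]
    simp only [← Finset.sum_neg_distrib]
    exact Finset.sum_congr rfl fun s _ => Finset.sum_congr rfl fun t _ => hf t s
  rw [hsum, Pi.zero_apply]
  linarith

/-- The boundary operator of the complex spanned by the family `F`. -/
def bdryOn (F : Set (Finset V)) : (Finset V → ℤ) →ₗ[ℤ] (Finset V → ℤ) := trunc F ∘ₗ del

lemma bdryOn_apply_of_mem {F : Set (Finset V)} {S : Finset V} (h : S ∈ F)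
    (x : Finset V → ℤ) : bdryOn F x S = del x S := trunc_apply_of_mem h _

lemma bdryOn_apply_of_notMem {F : Set (Finset V)} {S : Finset V} (h : S ∉ F)
    (x : Finset V → ℤ) : bdryOn F x S = 0 := trunc_apply_of_notMem h _

lemma exists_of_del_ne_zero {x : Finset V → ℤ} {S : Finset V} (h : del x S ≠ 0) :
    ∃ s ∉ S, x (insert s S) ≠ 0 := by
  by_contra! h'
  refine h (Finset.sum_eq_zero fun s _ => ?_)
  split_ifs with hs
  · rfl
  · rw [h' s hs, mul_zero]

lemma bdryOn_mem {F G : Set (Finset V)} {n k : ℤ} (hk : k = n + 1) {x : Finset V → ℤ}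
    (hx : x ∈ chainsOn G k) : bdryOn F x ∈ chainsOn F n := by
  intro S hS
  by_cases h : S ∈ F
  · rw [bdryOn_apply_of_mem h] at hS
    obtain ⟨s, hs, hne⟩ := exists_of_del_ne_zero hS
    have := (hx _ hne).2
    rw [Finset.card_insert_of_notMem hs] at this
    push_cast at this
    exact ⟨h, by linarith⟩
  · exact absurd (bdryOn_apply_of_notMem h x) hS

/-- A family of sets is convex if it contains every set lying between two of its members. -/
def ConvexFamily (F : Set (Finset V)) : Prop :=
  ∀ S ∈ F, ∀ U ∈ F, ∀ T, S ⊆ T → T ⊆ U → T ∈ F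

lemma bdryOn_bdryOn {F : Set (Finset V)} (hF : ConvexFamily F) {n : ℤ} {x : Finset V → ℤ}
    (hx : x ∈ chainsOn F n) : bdryOn F (bdryOn F x) = 0 := by
  funext S
  by_cases h : S ∈ F
  · rw [bdryOn_apply_of_mem h, Pi.zero_apply, ← Pi.zero_apply (M := fun _ => ℤ) S,
      ← del_del x, del_apply, del_apply]
    refine Finset.sum_congr rfl fun s _ => ?_
    split_ifs with hs
    · rfl
    · congr 1
      by_cases h' : insert s S ∈ F
      · exact bdryOn_apply_of_mem h' x
      · rw [bdryOn_apply_of_notMem h']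
        by_contra hne
        obtain ⟨t, ht, hxt⟩ := exists_of_del_ne_zero (Ne.symm hne)
        exact h' (hF S h _ (hx _ hxt).1 _ (Finset.subset_insert _ _) (Finset.subset_insert _ _))
  · exact bdryOn_apply_of_notMem h _

/-- Cycles with `n` elements of the complex spanned by `F`. -/
def cyclesOn (F : Set (Finset V)) (n : ℤ) : Submodule ℤ (Finset V → ℤ) :=
  chainsOn F n ⊓ LinearMap.ker (bdryOn F)

/-- Boundaries with `n` elements of the complex spanned by `F`. -/
def boundariesOn (F : Set (Finset V)) (n : ℤ) : Submodule ℤ (Finset V → ℤ) :=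
  (chainsOn F (n + 1)).map (bdryOn F)

lemma mem_cyclesOn {F : Set (Finset V)} {n : ℤ} {x : Finset V → ℤ} :
    x ∈ cyclesOn F n ↔ x ∈ chainsOn F n ∧ bdryOn F x = 0 := Iff.rfl

lemma mem_boundariesOn {F : Set (Finset V)} {n : ℤ} {x : Finset V → ℤ} :
    x ∈ boundariesOn F n ↔ ∃ y ∈ chainsOn F (n + 1), bdryOn F y = x := Iff.rfl

/-- The complex spanned by `F` is exact in the degree of `n`-element sets. -/
def ExactOn (F : Set (Finset V)) (n : ℤ) : Prop := cyclesOn F n ≤ boundariesOn F n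

/-- The homology of the complex spanned by `F` is concentrated in the degree of `r`-element
sets, and there it is free of rank `t`, with a basis given by classes of cycles. -/
def ConcentratedOn (F : Set (Finset V)) (r : ℤ) (t : ℕ) : Prop :=
  (∀ n, n ≠ r → ExactOn F n) ∧
  ∃ (ι : Type) (_ : Fintype ι) (z : ι → Finset V → ℤ), Fintype.card ι = t ∧
    (∀ i, z i ∈ cyclesOn F r) ∧
    (∀ x ∈ cyclesOn F r, ∃ c : ι → ℤ, x - ∑ i, c i • z i ∈ boundariesOn F r) ∧
    ∀ c : ι → ℤ, ∑ i, c i • z i ∈ boundariesOn F r → c = 0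

lemma concentratedOn_zero_of_exactOn {F : Set (Finset V)} (h : ∀ n, ExactOn F n) (r : ℤ) :
    ConcentratedOn F r 0 := by
  refine ⟨fun n _ => h n, Empty, inferInstance, Empty.elim, rfl, fun i => i.elim,
    fun x hx => ⟨Empty.elim, ?_⟩, fun c _ => funext fun i => i.elim⟩
  simpa using h r hx

lemma concentratedOn_empty (r : ℤ) : ConcentratedOn (∅ : Set (Finset V)) r 0 := by
  refine concentratedOn_zero_of_exactOn (fun n x hx => ?_) r
  have : x = 0 := by
    funext S
    exact apply_eq_zero_of_notMem hx.1 (Set.notMem_empty S)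
  rw [this]
  exact Submodule.zero_mem _

lemma concentratedOn_singleton (T : Finset V) : ConcentratedOn {T} T.card 1 := by
  have hbd : ∀ n, ∀ x ∈ boundariesOn {T} n, x T = 0 := by
    rintro n x ⟨y, hy, rfl⟩
    rw [bdryOn_apply_of_mem (Set.mem_singleton T)]
    by_contra h
    obtain ⟨s, hs, hne⟩ := exists_of_del_ne_zero h
    exact hs (by rw [← (hy _ hne).1]; exact Finset.mem_insert_self _ _)
  refine ⟨fun n hn x hx => ?_, Unit, inferInstance, fun _ => Pi.single T 1, rfl, fun _ => ?_,
    fun x hx => ⟨fun _ => x T, ?_⟩, fun c hc => ?_⟩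
  · have : x = 0 := by
      funext S
      by_contra h
      obtain ⟨rfl, h2⟩ := hx.1 S h
      exact hn h2.symm
    rw [this]
    exact Submodule.zero_mem _
  · have hmem : (Pi.single T 1 : Finset V → ℤ) ∈ chainsOn {T} T.card := by
      intro S hS
      by_cases h : S = T
      · exact ⟨h, by rw [h]⟩
      · exact absurd (Pi.single_eq_of_ne h 1) hS
    refine mem_cyclesOn.2 ⟨hmem, ?_⟩
    funext S
    by_cases h : S ∈ ({T} : Set (Finset V))
    · obtain rfl : S = T := h
      exact hbd (S.card - 1) _ ⟨_, by simpa using hmem, rfl⟩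
    · exact bdryOn_apply_of_notMem h _
  · convert Submodule.zero_mem _
    funext S
    by_cases h : S = T
    · subst h
      simp
    · simp [h, apply_eq_zero_of_notMem hx.1 (S := S) h]
  · have := hbd _ _ hc
    funext i
    simpa using this

/-- A family stable under toggling the element `f` spans an exact complex. -/
lemma exactOn_of_toggle {F : Set (Finset V)} (f : V)
    (hf : ∀ S S', f ∉ S → f ∈ S' → (∀ v, v ≠ f → (v ∈ S' ↔ v ∈ S)) → (S ∈ F ↔ S' ∈ F))
    (n : ℤ) : ExactOn F n := by
  replace hf : ∀ S, f ∉ S → (S ∈ F ↔ insert f S ∈ F) := fun S hS =>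
    hf S _ hS (Finset.mem_insert_self _ _) fun v hv => by simp [hv]
  intro z hz
  obtain ⟨hz, hdz⟩ := mem_cyclesOn.1 hz
  refine mem_boundariesOn.2
    ⟨fun S => if f ∈ S then incSign f (S.erase f) * z (S.erase f) else 0, ?_, ?_⟩
  · intro S hS
    by_cases h : f ∈ S
    · simp only [if_pos h] at hS
      have hne : z (S.erase f) ≠ 0 := fun h0 => hS (by rw [h0, mul_zero])
      obtain ⟨h1, h2⟩ := hz _ hne
      rw [hf _ (Finset.notMem_erase f S), Finset.insert_erase h] at h1
      rw [← Finset.card_erase_add_one h]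
      exact ⟨h1, by push_cast; linarith⟩
    · exact absurd (if_neg h) hS
  · funext S
    by_cases hS : S ∈ F
    swap
    · rw [bdryOn_apply_of_notMem hS, apply_eq_zero_of_notMem hz hS]
    rw [bdryOn_apply_of_mem hS, del_apply]
    by_cases h : f ∈ S
    · obtain ⟨R, hR, rfl⟩ : ∃ R, f ∉ R ∧ insert f R = S :=
        ⟨S.erase f, Finset.notMem_erase _ _, Finset.insert_erase h⟩
      have hRF : R ∈ F := (hf R hR).2 hS
      have hcyc : del z R = 0 := by
        rw [← bdryOn_apply_of_mem hRF, hdz, Pi.zero_apply]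
      rw [del_apply, ← Finset.add_sum_erase _ _ (Finset.mem_univ f), if_neg hR] at hcyc
      rw [← Finset.add_sum_erase _ _ (Finset.mem_univ f), if_pos h, zero_add]
      have hterm : ∀ s ∈ Finset.univ.erase f,
          (if s ∈ insert f R then 0 else incSign s (insert f R) *
            if f ∈ insert s (insert f R) then
              incSign f ((insert s (insert f R)).erase f) * z ((insert s (insert f R)).erase f)
            else 0) =
          -incSign f R * (if s ∈ R then 0 else incSign s R * z (insert s R)) := by
        intro s hs
        have hsf : s ≠ f := Finset.ne_of_mem_erase hs
        by_cases hsR : s ∈ R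
        · simp [hsR]
        · have h1 : s ∉ insert f R := by simp [hsf, hsR]
          have h2 : f ∈ insert s (insert f R) := by simp
          have h3 : (insert s (insert f R)).erase f = insert s R := by
            rw [Finset.insert_comm, Finset.erase_insert]
            simp [hR, hsf.symm]
          rw [if_neg h1, if_pos h2, if_neg hsR, h3]
          have hswap := incSign_swap hsR hR hsf
          have e2 := incSign_mul_self f R
          have key : incSign s (insert f R) * incSign f (insert s R) =
              -incSign f R * incSign s R := by
            have h4 := incSign_mul_self f (insert s R)
            linear_combination (incSign f R * incSign f (insert s R)) * hswap
              - (incSign s (insert f R) * incSign f (insert s R)) * e2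
              - incSign f R * incSign s R * h4
          linear_combination z (insert s R) * key
      rw [Finset.sum_congr rfl hterm, ← Finset.mul_sum]
      linear_combination -incSign f R * hcyc + z (insert f R) * incSign_mul_self f R
    · rw [Finset.sum_eq_single f]
      · rw [if_neg h, if_pos (Finset.mem_insert_self _ _), Finset.erase_insert h, ← mul_assoc,
          incSign_mul_self, one_mul]
      · intro s _ hs
        have : f ∉ insert s S := by simp [h, hs.symm]
        simp [this]
      · simp

namespace SplitFamily

variable {F F₀ F₁ : Set (Finset V)}

lemma bdryOn_eq (h : SplitFamily F F₀ F₁) {n : ℤ} {x : Finset V → ℤ}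
    (hx : x ∈ chainsOn F₀ n) : bdryOn F x = bdryOn F₀ x := by
  funext S
  by_cases h0 : S ∈ F₀
  · rw [bdryOn_apply_of_mem h0, bdryOn_apply_of_mem ((h.mem_iff S).2 (Or.inl h0))]
  rw [bdryOn_apply_of_notMem h0]
  by_cases hS : S ∈ F
  swap
  · exact bdryOn_apply_of_notMem hS x
  rw [bdryOn_apply_of_mem hS]
  by_contra hne
  obtain ⟨s, -, hs⟩ := exists_of_del_ne_zero hne
  exact h.not_subset S (((h.mem_iff S).1 hS).resolve_left h0) _ (hx _ hs).1
    (Finset.subset_insert _ _)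

lemma trunc_bdryOn (h : SplitFamily F F₀ F₁) {n : ℤ} {x : Finset V → ℤ}
    (hx : x ∈ chainsOn F n) : trunc F₁ (bdryOn F x) = bdryOn F₁ (trunc F₁ x) := by
  have hx0 : x - trunc F₁ x ∈ chainsOn F₀ n := by
    refine h.mem_chainsOn₀ (sub_mem hx (h.le₁ n (trunc_mem_chainsOn hx))) ?_
    funext S
    by_cases hS : S ∈ F₁
    · simp [trunc_apply_of_mem hS]
    · exact trunc_apply_of_notMem hS _
  have h1 : trunc F₁ (bdryOn F (x - trunc F₁ x)) = 0 := by
    rw [h.bdryOn_eq hx0]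
    exact h.trunc_eq_zero (bdryOn_mem (n := n - 1) (by ring) hx0)
  rw [map_sub, map_sub, sub_eq_zero] at h1
  rw [h1]
  funext S
  by_cases hS : S ∈ F₁
  · rw [trunc_apply_of_mem hS, bdryOn_apply_of_mem hS,
      bdryOn_apply_of_mem ((h.mem_iff S).2 (Or.inr hS))]
  · rw [trunc_apply_of_notMem hS, bdryOn_apply_of_notMem hS]

lemma trunc_mem_cyclesOn (h : SplitFamily F F₀ F₁) {n : ℤ} {x : Finset V → ℤ}
    (hx : x ∈ cyclesOn F n) : trunc F₁ x ∈ cyclesOn F₁ n :=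
  mem_cyclesOn.2 ⟨trunc_mem_chainsOn hx.1, by
    rw [← h.trunc_bdryOn hx.1, (mem_cyclesOn.1 hx).2, map_zero]⟩

lemma trunc_mem_boundariesOn (h : SplitFamily F F₀ F₁) {n : ℤ} {x : Finset V → ℤ}
    (hx : x ∈ boundariesOn F n) : trunc F₁ x ∈ boundariesOn F₁ n := by
  obtain ⟨y, hy, rfl⟩ := hx
  exact ⟨_, trunc_mem_chainsOn hy, (h.trunc_bdryOn hy).symm⟩

lemma boundariesOn_le (h : SplitFamily F F₀ F₁) (n : ℤ) :
    boundariesOn F₀ n ≤ boundariesOn F n := by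
  rintro _ ⟨y, hy, rfl⟩
  exact ⟨y, h.le₀ _ hy, h.bdryOn_eq hy⟩

lemma cyclesOn_le (h : SplitFamily F F₀ F₁) (n : ℤ) : cyclesOn F₀ n ≤ cyclesOn F n :=
  fun _ hx => mem_cyclesOn.2 ⟨h.le₀ n hx.1, (h.bdryOn_eq hx.1).trans hx.2⟩

/-- Exactness of the homology sequence at the homology of `F`. -/
lemma exists_cyclesOn₀ (h : SplitFamily F F₀ F₁) (hF : ConvexFamily F) {n : ℤ}
    {x : Finset V → ℤ} (hx : x ∈ cyclesOn F n) (hx1 : trunc F₁ x ∈ boundariesOn F₁ n) :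
    ∃ x₀ ∈ cyclesOn F₀ n, x - x₀ ∈ boundariesOn F n := by
  obtain ⟨y, hy, hyx⟩ := hx1
  have hyF := h.le₁ _ hy
  have h0 : x - bdryOn F y ∈ chainsOn F₀ n := by
    refine h.mem_chainsOn₀ (sub_mem hx.1 (bdryOn_mem rfl hyF)) ?_
    rw [map_sub, h.trunc_bdryOn hyF, trunc_eq_self hy, hyx, sub_self]
  refine ⟨x - bdryOn F y, mem_cyclesOn.2 ⟨h0, ?_⟩, ?_⟩
  · rw [← h.bdryOn_eq h0, map_sub, bdryOn_bdryOn hF hyF, (mem_cyclesOn.1 hx).2, sub_zero]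
  · rw [sub_sub_cancel]
    exact ⟨y, hyF, rfl⟩

/-- Cycles of the quotient lift when the subcomplex is exact one degree below. -/
lemma exists_lift (h : SplitFamily F F₀ F₁) (hF : ConvexFamily F) {n : ℤ}
    (hex : ExactOn F₀ (n - 1)) {x : Finset V → ℤ} (hx : x ∈ cyclesOn F₁ n) :
    ∃ y ∈ cyclesOn F n, trunc F₁ y = x := by
  have hxF := h.le₁ n hx.1
  have hw : bdryOn F x ∈ chainsOn F₀ (n - 1) := by
    refine h.mem_chainsOn₀ (bdryOn_mem (by ring) hxF) ?_
    rw [h.trunc_bdryOn hxF, trunc_eq_self hx.1, (mem_cyclesOn.1 hx).2]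
  obtain ⟨y, hy, hyx⟩ := hex (mem_cyclesOn.2 ⟨hw, by
    rw [← h.bdryOn_eq hw, bdryOn_bdryOn hF hxF]⟩)
  rw [sub_add_cancel] at hy
  refine ⟨x - y, mem_cyclesOn.2 ⟨sub_mem hxF (h.le₀ n hy), ?_⟩, ?_⟩
  · rw [map_sub, h.bdryOn_eq hy, hyx, sub_self]
  · rw [map_sub, trunc_eq_self hx.1, h.trunc_eq_zero hy, sub_zero]

/-- Boundaries lying in the subcomplex are boundaries there when the quotient is exact one
degree above. -/
lemma mem_boundariesOn₀ (h : SplitFamily F F₀ F₁) (hF : ConvexFamily F) {n : ℤ}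
    (hex : ExactOn F₁ (n + 1)) {x : Finset V → ℤ} (hx0 : x ∈ chainsOn F₀ n)
    (hx : x ∈ boundariesOn F n) : x ∈ boundariesOn F₀ n := by
  obtain ⟨y, hy, rfl⟩ := hx
  obtain ⟨u, hu, huy⟩ := hex (mem_cyclesOn.2 ⟨trunc_mem_chainsOn (G := F₁) hy, by
    rw [← h.trunc_bdryOn hy, h.trunc_eq_zero hx0]⟩)
  have huF := h.le₁ _ hu
  have h0 : y - bdryOn F u ∈ chainsOn F₀ (n + 1) := by
    refine h.mem_chainsOn₀ (sub_mem hy (bdryOn_mem rfl huF)) ?_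
    rw [map_sub, h.trunc_bdryOn huF, trunc_eq_self hu, huy, sub_self]
  refine ⟨_, h0, ?_⟩
  rw [← h.bdryOn_eq h0, map_sub, bdryOn_bdryOn hF huF, sub_zero]

lemma concentratedOn (h : SplitFamily F F₀ F₁) (hF : ConvexFamily F) {r : ℤ} {t₀ t₁ : ℕ}
    (h₀ : ConcentratedOn F₀ r t₀) (h₁ : ConcentratedOn F₁ r t₁) :
    ConcentratedOn F r (t₀ + t₁) := by
  obtain ⟨ex₀, ι₀, _, z₀, hc₀, hz₀, hs₀, hi₀⟩ := h₀
  obtain ⟨ex₁, ι₁, _, z₁, hc₁, hz₁, hs₁, hi₁⟩ := h₁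
  refine ⟨fun n hn x hx => ?_, ?_⟩
  · obtain ⟨x₀, hx₀, hxx⟩ := h.exists_cyclesOn₀ hF hx (ex₁ n hn (h.trunc_mem_cyclesOn hx))
    have := add_mem hxx (h.boundariesOn_le n (ex₀ n hn hx₀))
    rwa [sub_add_cancel] at this
  choose w hw hwz using fun i => h.exists_lift hF (ex₀ (r - 1) (by linarith)) (hz₁ i)
  have htr : ∀ c : ι₁ → ℤ, trunc F₁ (∑ i, c i • w i) = ∑ i, c i • z₁ i := by
    intro c
    simp only [map_sum, map_smul, hwz]
  refine ⟨ι₀ ⊕ ι₁, inferInstance, Sum.elim z₀ w, by rw [Fintype.card_sum, hc₀, hc₁], ?_,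
    fun x hx => ?_, fun c hc => ?_⟩
  · rintro (i | i)
    · exact h.cyclesOn_le r (hz₀ i)
    · exact hw i
  · obtain ⟨c₁, hc₁⟩ := hs₁ _ (h.trunc_mem_cyclesOn hx)
    rw [← htr, ← map_sub] at hc₁
    obtain ⟨x₀, hx₀, hxx⟩ := h.exists_cyclesOn₀ hF
      (sub_mem hx (sum_mem fun i _ => Submodule.smul_mem _ (c₁ i) (hw i))) hc₁
    obtain ⟨c₀, hc₀⟩ := hs₀ _ hx₀
    refine ⟨Sum.elim c₀ c₁, ?_⟩
    have := add_mem hxx (h.boundariesOn_le r hc₀)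
    convert this using 1
    simp only [Fintype.sum_sum_type, Sum.elim_inl, Sum.elim_inr]
    abel
  · simp only [Fintype.sum_sum_type, Sum.elim_inl, Sum.elim_inr] at hc
    have hmem₀ : ∑ i, c (Sum.inl i) • z₀ i ∈ chainsOn F₀ r :=
      sum_mem fun i _ => Submodule.smul_mem _ _ (hz₀ i).1
    have hzero₁ : (fun i => c (Sum.inr i)) = 0 := by
      refine hi₁ _ ?_
      have := h.trunc_mem_boundariesOn hc
      rwa [map_add, htr fun i => c (Sum.inr i), h.trunc_eq_zero hmem₀, zero_add] at this
    have hzero₁' : ∀ i, c (Sum.inr i) = 0 := congrFun hzero₁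
    simp only [hzero₁', zero_smul, Finset.sum_const_zero, add_zero] at hc
    have hzero₀ : (fun i => c (Sum.inl i)) = 0 :=
      hi₀ _ (h.mem_boundariesOn₀ hF (ex₁ (r + 1) (by linarith)) hmem₀ hc)
    funext i
    rcases i with i | i
    · exact congrFun hzero₀ i
    · exact hzero₁' i

end SplitFamily

lemma inter_eq_iff {α : Type*} [DecidableEq α] {U N S : Finset α} (hN : N ⊆ U) :
    S ∩ U = N ↔ ∀ v ∈ U, v ∈ S ↔ v ∈ N := by
  constructor
  · rintro rfl v hv
    simp [hv]
  · intro h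
    ext v
    rw [Finset.mem_inter]
    exact ⟨fun hv => (h v hv.2).1 hv.1, fun hv => ⟨(h v (hN hv)).2 hv, hN hv⟩⟩

/-- Fibres of the trace on a finite set `U` of elements, glued together. -/
lemma concentratedOn_of_traces (U : Finset V) (r : ℤ) (t : Finset V → ℕ)
    (F : Set (Finset V)) (hF : ConvexFamily F)
    (h : ∀ N ⊆ U, ConcentratedOn {S ∈ F | ∀ v ∈ U, v ∈ S ↔ v ∈ N} r (t N)) :
    ConcentratedOn F r (∑ N ∈ U.powerset, t N) := by
  replace h : ∀ N ∈ U.powerset, ConcentratedOn {S ∈ F | S ∩ U = N} r (t N) := by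
    intro N hN
    have hN' := Finset.mem_powerset.1 hN
    simpa only [inter_eq_iff hN'] using h N hN'
  induction U using Finset.induction_on generalizing t F with
  | empty =>
    simpa using h ∅ (by simp)
  | insert e U he ih =>
    rw [Finset.sum_powerset_insert he]
    refine (splitFamily_mem F e).concentratedOn hF (ih t _ ?_ fun N hN => ?_)
      (ih (fun N => t (insert e N)) _ ?_ fun N hN => ?_)
    · exact fun S hS T hT R hSR hRT => ⟨hF S hS.1 T hT.1 R hSR hRT, fun h' => hT.2 (hRT h')⟩
    · have heN : e ∉ N := fun h' => he (Finset.mem_powerset.1 hN h')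
      convert h N (Finset.mem_powerset.2
        ((Finset.mem_powerset.1 hN).trans (Finset.subset_insert _ _))) using 1
      ext S
      simp only [Set.mem_ofPred_eq, and_assoc]
      refine and_congr_right fun _ => ⟨fun ⟨h1, h2⟩ => ?_, fun h2 => ?_⟩
      · rw [Finset.inter_insert_of_notMem h1, h2]
      · have h1 : e ∉ S := by
          intro h1
          rw [← h2] at heN
          exact heN (by simp [h1])
        rw [Finset.inter_insert_of_notMem h1] at h2
        exact ⟨h1, h2⟩
    · exact fun S hS T hT R hSR hRT => ⟨hF S hS.1 T hT.1 R hSR hRT, hSR hS.2⟩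
    · have heN : e ∉ N := fun h' => he (Finset.mem_powerset.1 hN h')
      convert h (insert e N) (Finset.mem_powerset.2
        (Finset.insert_subset_insert _ (Finset.mem_powerset.1 hN))) using 1
      ext S
      simp only [Set.mem_ofPred_eq, and_assoc]
      refine and_congr_right fun _ => ⟨fun ⟨h1, h2⟩ => ?_, fun h2 => ?_⟩
      · rw [Finset.inter_insert_of_mem h1, h2]
      · have h1 : e ∈ S := by
          have : e ∈ S ∩ insert e U := by
            rw [h2]
            exact Finset.mem_insert_self _ _
          exact Finset.mem_of_mem_inter_left this
        rw [Finset.inter_insert_of_mem h1] at h2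
        refine ⟨h1, ?_⟩
        have h3 : e ∉ S ∩ U := fun h' => he (Finset.mem_of_mem_inter_right h')
        rw [← Finset.erase_insert h3, h2, Finset.erase_insert heN]

end ConvexFamilies

section ConnectedCollections

variable {m : ℕ} {A : Fin m → ℕ} {b : ℕ}

/-- An edge of the `j`-th complete graph is inner for `k` if both of its nodes are among the
first `k j` ones. Elements of `B` are never inner. -/
def IsInner (k : Fin m → ℕ) : Vtx m A b → Prop
  | Sum.inl ⟨j, e⟩ => (e.1.2 : ℕ) < k j
  | Sum.inr _ => False

/-- For every `j`, the inner edges of `S` connect the first `k j` nodes: a two-colouring that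
is constant along these edges is constant on these nodes. -/
def InnerConnected (k : Fin m → ℕ) (S : Finset (Vtx m A b)) : Prop :=
  ∀ j, ∀ c : Fin (A j) → Prop,
    (∀ e : Edge (A j), (Sum.inl ⟨j, e⟩ : Vtx m A b) ∈ S → (e.1.2 : ℕ) < k j →
      (c e.1.1 ↔ c e.1.2)) →
    ∀ x y : Fin (A j), (x : ℕ) < k j → (y : ℕ) < k j → (c x ↔ c y)

/-- The sets that agree with `T` outside the inner edges and whose inner edges connect the
inner nodes. -/
def innerFamily (k : Fin m → ℕ) (T : Finset (Vtx m A b)) : Set (Finset (Vtx m A b)) :=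
  {S | (∀ v, ¬IsInner k v → (v ∈ S ↔ v ∈ T)) ∧ InnerConnected k S}

lemma InnerConnected.mono {k : Fin m → ℕ} {S T : Finset (Vtx m A b)}
    (hS : InnerConnected k S) (h : S ⊆ T) : InnerConnected k T :=
  fun j c hc => hS j c fun e he => hc e (h he)

lemma convexFamily_innerFamily (k : Fin m → ℕ) (T : Finset (Vtx m A b)) :
    ConvexFamily (innerFamily k T) := by
  intro S hS U hU R hSR hRU
  refine ⟨fun v hv => ⟨fun h => (hU.1 v hv).1 (hRU h), fun h => hSR ((hS.1 v hv).2 h)⟩,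
    hS.2.mono hSR⟩

lemma innerFamily_eq_singleton {k : Fin m → ℕ} (hk : ∀ j, k j = 1) (T : Finset (Vtx m A b)) :
    innerFamily k T = {T} := by
  have hin : ∀ v : Vtx m A b, ¬IsInner k v := by
    rintro (⟨j, e⟩ | i) h
    · have h1 : (e.1.2 : ℕ) < k j := h
      have h2 : (e.1.1 : ℕ) < e.1.2 := e.2
      rw [hk] at h1
      omega
    · exact h
  ext S
  refine ⟨fun h => Finset.ext fun v => h.1 v (hin v), ?_⟩
  rintro rfl
  refine ⟨fun v _ => Iff.rfl, fun j c _ x y hx hy => ?_⟩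
  rw [hk] at hx hy
  rw [show x = y from Fin.ext (by omega)]

section Star

variable {k : Fin m → ℕ} {j : Fin m} {n : ℕ}

/-- The edge joining the node `i` to the node `n` of the `j`-th node set. -/
def starEdge (b : ℕ) (j : Fin m) {n : ℕ} (hn : n < A j) (i : Fin n) : Vtx m A b :=
  Sum.inl ⟨j, ⟨(⟨i, i.2.trans hn⟩, ⟨n, hn⟩), i.2⟩⟩

lemma starEdge_injective (hn : n < A j) : Function.Injective (starEdge b j hn) := by
  intro i i' h
  simp only [starEdge, Sum.inl.injEq, Sigma.mk.injEq, heq_eq_eq, true_and, Subtype.mk.injEq,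
    Prod.mk.injEq, Fin.mk.injEq, and_true] at h
  exact Fin.ext h

lemma starEdge_eq {e : Edge (A j)} (h : (e.1.2 : ℕ) = n) (hn : n < A j)
    (hlt : (e.1.1 : ℕ) < n) : starEdge b j hn ⟨e.1.1, hlt⟩ = Sum.inl ⟨j, e⟩ := by
  simp only [starEdge, Sum.inl.injEq, Sigma.mk.injEq, heq_eq_eq, true_and]
  exact Subtype.ext (Prod.ext (Fin.ext rfl) (Fin.ext h.symm))

/-- All the edges joining the node `n` of the `j`-th node set to smaller nodes. -/
def starEdges (b : ℕ) (j : Fin m) {n : ℕ} (hn : n < A j) : Finset (Vtx m A b) :=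
  Finset.univ.map ⟨starEdge b j hn, starEdge_injective hn⟩

lemma mem_starEdges {hn : n < A j} {v : Vtx m A b} :
    v ∈ starEdges b j hn ↔ ∃ i, starEdge b j hn i = v := by
  simp [starEdges]

lemma inner_update_iff (hkj : k j = n + 1) (hn : n < A j) (v : Vtx m A b) :
    IsInner (Function.update k j n) v ↔ IsInner k v ∧ v ∉ starEdges b j hn := by
  rcases v with ⟨j', e⟩ | i
  swap
  · simp [IsInner]
  by_cases hj : j' = j
  · subst hj
    have hmem : (Sum.inl ⟨j', e⟩ : Vtx m A b) ∈ starEdges b j' hn ↔ (e.1.2 : ℕ) = n := by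
      rw [mem_starEdges]
      constructor
      · rintro ⟨i, hi⟩
        simp only [starEdge, Sum.inl.injEq, Sigma.mk.injEq, heq_eq_eq, true_and] at hi
        rw [← hi]
      · intro h
        have hlt : (e.1.1 : ℕ) < e.1.2 := e.2
        exact ⟨⟨e.1.1, by omega⟩, starEdge_eq h hn (by omega)⟩
    rw [hmem]
    simp only [IsInner, Function.update_self, hkj]
    omega
  · have hmem : (Sum.inl ⟨j', e⟩ : Vtx m A b) ∉ starEdges b j hn := by
      rw [mem_starEdges]
      rintro ⟨i, hi⟩
      simp only [starEdge, Sum.inl.injEq, Sigma.mk.injEq] at hi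
      exact hj hi.1.symm
    simp [IsInner, Function.update_of_ne hj, hmem]

lemma inner_starEdge (hkj : k j = n + 1) (hn : n < A j) (i : Fin n) :
    IsInner k (starEdge b j hn i) := by
  simp [starEdge, IsInner, hkj]

/-- If no edge joins the last inner node to the others, the inner nodes are not connected. -/
lemma not_innerConnected_of_disjoint (hkj : k j = n + 1) (hn : n < A j) (hn0 : 0 < n)
    {S : Finset (Vtx m A b)} (hS : ∀ i, starEdge b j hn i ∉ S) : ¬InnerConnected k S := by
  intro h
  have := h j (fun x => (x : ℕ) = n) (fun e he hek => ?_) ⟨0, by omega⟩ ⟨n, hn⟩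
    (by simp [hkj]) (by simp [hkj])
  · simp at this
    omega
  · have hlt : (e.1.1 : ℕ) < e.1.2 := e.2
    have hne : (e.1.2 : ℕ) ≠ n := by
      intro h'
      refine hS ⟨e.1.1, by omega⟩ ?_
      rwa [starEdge_eq h' hn]
    constructor <;> intro <;> omega

/-- If two edges at the last inner node are present, the edge closing the triangle does not
affect connectivity. -/
lemma innerConnected_of_triangle (hkj : k j = n + 1) (hn : n < A j) {i i' : Fin n}
    (hii : i < i') {S S' : Finset (Vtx m A b)} (hi : starEdge b j hn i ∈ S)
    (hi' : starEdge b j hn i' ∈ S)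
    (hSS : ∀ v ∈ S', v ∈ S ∨ v = starEdge b j (i'.2.trans hn) ⟨i, hii⟩)
    (h : InnerConnected k S') : InnerConnected k S := by
  intro j' c hc
  refine h j' c fun e he hek => ?_
  rcases hSS _ he with h1 | h1
  · exact hc e h1 hek
  · simp only [starEdge, Sum.inl.injEq, Sigma.mk.injEq] at h1
    obtain ⟨rfl, h2⟩ := h1
    rw [heq_eq_eq] at h2
    subst h2
    have e1 := hc _ hi (by simp [hkj])
    have e2 := hc _ hi' (by simp [hkj])
    exact e1.trans e2.symm

/-- A node with a single edge can be removed without affecting connectivity. -/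
lemma innerConnected_update_iff (hkj : k j = n + 1) (hn : n < A j)
    {S : Finset (Vtx m A b)} {i : Fin n} (hS : ∀ i', starEdge b j hn i' ∈ S ↔ i' = i) :
    InnerConnected (Function.update k j n) S ↔ InnerConnected k S := by
  have hother : ∀ j', j' ≠ j → Function.update k j n j' = k j' := fun j' hj' =>
    Function.update_of_ne hj' _ _
  have hcase : ∀ e : Edge (A j), (Sum.inl ⟨j, e⟩ : Vtx m A b) ∈ S → (e.1.2 : ℕ) = n →
      e.1.1 = ⟨i, i.2.trans hn⟩ := by
    intro e he h
    have hlt : (e.1.1 : ℕ) < e.1.2 := e.2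
    have := (hS ⟨e.1.1, by omega⟩).1 (by
      rwa [starEdge_eq h hn])
    exact Fin.ext (congrArg Fin.val this :)
  constructor
  · intro h j' c hc
    by_cases hj : j' = j
    swap
    · have := h j' c
      rw [hother j' hj] at this
      exact this hc
    subst hj
    have hcon := h j' c
    simp only [Function.update_self] at hcon
    have hcon' := hcon fun e he hek => hc e he (by omega)
    have hlast : c ⟨i, i.2.trans hn⟩ ↔ c ⟨n, hn⟩ := hc _ ((hS i).2 rfl) (by simp [hkj])
    have hall : ∀ x : Fin (A j'), (x : ℕ) < k j' → (c x ↔ c ⟨i, i.2.trans hn⟩) := by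
      intro x hx
      by_cases hxn : (x : ℕ) = n
      · rw [show x = ⟨n, hn⟩ from Fin.ext hxn]
        exact hlast.symm
      · exact hcon' _ _ (by omega) i.2
    exact fun x y hx hy => (hall x hx).trans (hall y hy).symm
  · intro h j' c hc
    by_cases hj : j' = j
    swap
    · have := h j' c
      rw [hother j' hj] at hc ⊢
      exact this hc
    subst hj
    simp only [Function.update_self] at hc ⊢
    intro x y hx hy
    have := h j' (fun v => if (v : ℕ) = n then c ⟨i, i.2.trans hn⟩ else c v)
      (fun e he hek => ?_) x y (by omega) (by omega)
    · simpa [hx.ne, hy.ne] using this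
    · have hlt : (e.1.1 : ℕ) < e.1.2 := e.2
      by_cases hen : (e.1.2 : ℕ) = n
      · have h1 : (e.1.1 : ℕ) ≠ n := by omega
        simp only [hen, if_true, hcase e he hen, i.2.ne, if_false]
      · have h1 : (e.1.1 : ℕ) ≠ n := by omega
        simp only [hen, h1, if_false]
        exact hc e he (by omega)

end Star

variable [LinearOrder (Vtx m A b)]

/-- The part of an inner family with a prescribed set `N` of edges at the last inner node. -/
lemma concentratedOn_trace {k : Fin m → ℕ} {j : Fin m} {n : ℕ} (hkj : k j = n + 1)
    (hn : n < A j) (hn0 : 0 < n) {T : Finset (Vtx m A b)} (hT : ∀ v ∈ T, ¬IsInner k v)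
    {r : ℤ} {t : ℕ}
    (ih : ∀ T' : Finset (Vtx m A b), T'.card = T.card + 1 →
      (∀ v ∈ T', ¬IsInner (Function.update k j n) v) →
      ConcentratedOn (innerFamily (Function.update k j n) T') r t)
    {N : Finset (Vtx m A b)} (hN : N ⊆ starEdges b j hn) :
    ConcentratedOn {S ∈ innerFamily k T | ∀ v ∈ starEdges b j hn, v ∈ S ↔ v ∈ N} r
      (if N.card = 1 then t else 0) := by
  have hstar : ∀ i, starEdge b j hn i ∈ starEdges b j hn := fun i => mem_starEdges.2 ⟨i, rfl⟩
  rcases Nat.lt_trichotomy N.card 1 with hc | hc | hc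
  · rw [if_neg hc.ne]
    obtain rfl : N = ∅ := by
      rw [← Finset.card_eq_zero]
      omega
    rw [Set.eq_empty_of_forall_notMem (s := {S ∈ innerFamily k T | _}) fun S hS => ?_]
    · exact concentratedOn_empty r
    refine not_innerConnected_of_disjoint hkj hn hn0 (fun i hi => ?_) hS.1.2
    simpa using (hS.2 _ (hstar i)).1 hi
  · rw [if_pos hc]
    obtain ⟨v, rfl⟩ := Finset.card_eq_one.1 hc
    obtain ⟨i, rfl⟩ := mem_starEdges.1 (hN (Finset.mem_singleton_self v))
    have hiT : starEdge b j hn i ∉ T := fun h => hT _ h (inner_starEdge hkj hn i)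
    convert ih (insert (starEdge b j hn i) T) (Finset.card_insert_of_notMem hiT) ?_ using 1
    · ext S
      have hS' : ∀ S : Finset (Vtx m A b),
          (∀ v ∈ starEdges b j hn, v ∈ S ↔ v ∈ ({starEdge b j hn i} : Finset _)) →
          (InnerConnected (Function.update k j n) S ↔ InnerConnected k S) := by
        intro S hS
        refine innerConnected_update_iff hkj hn (i := i) fun i' => ?_
        rw [hS _ (hstar i'), Finset.mem_singleton, (starEdge_injective hn).eq_iff]
      simp only [innerFamily, Set.mem_ofPred_eq, inner_update_iff hkj hn]
      constructor
      · rintro ⟨⟨h1, h2⟩, h3⟩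
        refine ⟨fun v hv => ?_, (hS' S h3).2 h2⟩
        rw [Finset.mem_insert]
        by_cases hvs : v ∈ starEdges b j hn
        · rw [h3 v hvs, Finset.mem_singleton]
          refine ⟨Or.inl, fun h => h.resolve_right fun h' => hT v h' ?_⟩
          obtain ⟨i', rfl⟩ := mem_starEdges.1 hvs
          exact inner_starEdge hkj hn i'
        · rw [h1 v (by tauto)]
          refine ⟨Or.inr, fun h => h.resolve_left fun h' => hvs (h' ▸ hstar i)⟩
      · rintro ⟨h1, h2⟩
        have h3 : ∀ v ∈ starEdges b j hn,
            v ∈ S ↔ v ∈ ({starEdge b j hn i} : Finset _) := by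
          intro v hvs
          rw [h1 v (by tauto), Finset.mem_insert, Finset.mem_singleton]
          refine ⟨fun h => h.resolve_right fun h' => hT v h' ?_, Or.inl⟩
          obtain ⟨i', rfl⟩ := mem_starEdges.1 hvs
          exact inner_starEdge hkj hn i'
        refine ⟨⟨fun v hv => ?_, (hS' S h3).1 h2⟩, h3⟩
        rw [h1 v (by tauto), Finset.mem_insert]
        refine ⟨fun h => h.resolve_left fun h' => hv ?_, Or.inr⟩
        rw [h']
        exact inner_starEdge hkj hn i
    · intro v hv
      rw [inner_update_iff hkj hn]
      rcases Finset.mem_insert.1 hv with rfl | hv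
      · exact fun h => h.2 (hstar i)
      · exact fun h => hT v hv h.1
  · rw [if_neg hc.ne']
    obtain ⟨i, i', hii, hi, hi'⟩ : ∃ i i' : Fin n, i < i' ∧ starEdge b j hn i ∈ N ∧
        starEdge b j hn i' ∈ N := by
      obtain ⟨v, hv, w, hw, hvw⟩ := Finset.one_lt_card.1 hc
      obtain ⟨i, rfl⟩ := mem_starEdges.1 (hN hv)
      obtain ⟨i', rfl⟩ := mem_starEdges.1 (hN hw)
      rcases lt_trichotomy i i' with h | h | h
      · exact ⟨i, i', h, hv, hw⟩
      · exact absurd (h ▸ rfl) hvw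
      · exact ⟨i', i, h, hw, hv⟩
    refine concentratedOn_zero_of_exactOn (exactOn_of_toggle
      (starEdge b j (i'.2.trans hn) ⟨i, hii⟩) fun S S' hS hfS' hmem => ?_) r
    set f : Vtx m A b := starEdge b j (i'.2.trans hn) ⟨i, hii⟩ with hf
    have hfin : IsInner (Function.update k j n) f := by
      simp [hf, starEdge, IsInner]
    rw [inner_update_iff hkj hn] at hfin
    simp only [innerFamily, Set.mem_ofPred_eq]
    have hne : ∀ v ∈ starEdges b j hn, v ≠ f := fun v hv h => hfin.2 (h ▸ hv)
    have hne' : ∀ v, ¬IsInner k v → v ≠ f := fun v hv h => hv (h ▸ hfin.1)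
    have e1 : (∀ v, ¬IsInner k v → (v ∈ S' ↔ v ∈ T)) ↔
        ∀ v, ¬IsInner k v → (v ∈ S ↔ v ∈ T) :=
      forall_congr' fun v => forall_congr' fun hv => by rw [hmem v (hne' v hv)]
    have e2 : (∀ v ∈ starEdges b j hn, (v ∈ S' ↔ v ∈ N)) ↔
        ∀ v ∈ starEdges b j hn, (v ∈ S ↔ v ∈ N) :=
      forall_congr' fun v => forall_congr' fun hv => by rw [hmem v (hne v hv)]
    have hsub : S ⊆ S' := fun v hv => (hmem v fun h => hS (h ▸ hv)).2 hv
    rw [e1, e2]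
    refine and_congr_left fun h => and_congr_right fun _ =>
      ⟨fun hc => hc.mono hsub, fun hc => ?_⟩
    refine innerConnected_of_triangle hkj hn hii ((h _ (hstar i)).2 hi)
      ((h _ (hstar i')).2 hi') (fun v hv => ?_) hc
    by_cases hvf : v = f
    · exact Or.inr hvf
    · exact Or.inl ((hmem v hvf).1 hv)

lemma concentratedOn_innerFamily (k : Fin m → ℕ) (hk : ∀ j, 1 ≤ k j) (hkA : ∀ j, k j ≤ A j)
    (T : Finset (Vtx m A b)) (hT : ∀ v ∈ T, ¬IsInner k v) :
    ConcentratedOn (innerFamily k T) (T.card + ∑ j, (k j - 1) : ℕ)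
      (∏ j, (k j - 1).factorial) := by
  induction hs : ∑ j, (k j - 1) generalizing k T with
  | zero =>
    have hk1 : ∀ j, k j = 1 := by
      intro j
      have := (Finset.sum_eq_zero_iff.1 hs) j (Finset.mem_univ j)
      have := hk j
      omega
    rw [innerFamily_eq_singleton hk1]
    simpa [hk1] using concentratedOn_singleton T
  | succ s ih =>
    obtain ⟨j, -, hj⟩ : ∃ j ∈ Finset.univ, k j - 1 ≠ 0 := by
      refine Finset.exists_ne_zero_of_sum_ne_zero ?_
      omega
    obtain ⟨n, hkj⟩ : ∃ n, k j = n + 1 := ⟨k j - 1, by omega⟩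
    have hn0 : 0 < n := by omega
    have hn : n < A j := by
      have := hkA j
      omega
    have hsum : ∑ i, (Function.update k j n i - 1) = s := by
      rw [← Finset.add_sum_erase _ _ (Finset.mem_univ j)] at hs ⊢
      rw [Finset.sum_congr rfl fun i hi => by
        rw [Function.update_of_ne (Finset.ne_of_mem_erase hi)]]
      rw [Function.update_self]
      omega
    have hprod : ∏ i, (k i - 1).factorial =
        n * ∏ i, (Function.update k j n i - 1).factorial := by
      rw [← Finset.mul_prod_erase _ _ (Finset.mem_univ j),
        ← Finset.mul_prod_erase _ (fun i => (Function.update k j n i - 1).factorial)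
          (Finset.mem_univ j), ← mul_assoc]
      congr 1
      · rw [Function.update_self, hkj, Nat.add_sub_cancel, Nat.mul_factorial_pred hn0.ne']
      · exact Finset.prod_congr rfl fun i hi => by
          rw [Function.update_of_ne (Finset.ne_of_mem_erase hi)]
    have hcount : ∑ N ∈ (starEdges b j hn).powerset,
        (if N.card = 1 then ∏ i, (Function.update k j n i - 1).factorial else 0) =
        ∏ i, (k i - 1).factorial := by
      rw [← Finset.sum_filter, Finset.sum_const, ← Finset.powersetCard_eq_filter,
        Finset.card_powersetCard, Nat.choose_one_right, hprod, smul_eq_mul]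
      simp [starEdges]
    rw [← hcount]
    refine concentratedOn_of_traces _ _ _ _ (convexFamily_innerFamily k T) fun N hN => ?_
    refine concentratedOn_trace hkj hn hn0 hT (fun T' hcard hT' => ?_) hN
    have := ih (Function.update k j n) ?_ ?_ T' hT' hsum
    · rwa [hcard, add_assoc, add_comm 1 s] at this
    · intro i
      by_cases hi : i = j
      · subst hi
        rw [Function.update_self]
        exact hn0
      · rw [Function.update_of_ne hi]
        exact hk i
    · intro i
      by_cases hi : i = j
      · subst hi
        rw [Function.update_self]
        exact hn.le
      · rw [Function.update_of_ne hi]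
        exact hkA i

end ConnectedCollections

section Comparison

variable {V : Type} (good : Finset V → Prop)

open Classical in
/-- The class of a chain in the quotient complex, as a function supported on good faces. -/
def goodPart (d : ℕ) : Chain V d →ₗ[ℤ] (Finset V → ℤ) where
  toFun x S := if h : good S ∧ S.card = d + 1 then x ⟨S, h.2⟩ else 0
  map_add' x y := by
    funext S
    simp only [Pi.add_apply, Finsupp.add_apply]
    split_ifs <;> simp
  map_smul' c x := by
    funext S
    simp

variable {good}

lemma goodPart_apply {d : ℕ} (x : Chain V d) {S : Finset V} (hS : good S)
    (hc : S.card = d + 1) : goodPart good d x S = x ⟨S, hc⟩ := dif_pos ⟨hS, hc⟩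

lemma goodPart_apply_of_not {d : ℕ} (x : Chain V d) {S : Finset V}
    (h : ¬(good S ∧ S.card = d + 1)) : goodPart good d x S = 0 := dif_neg h

lemma goodPart_mem_chainsOn {d : ℕ} (x : Chain V d) :
    goodPart good d x ∈ chainsOn {S | good S} (d + 1) := by
  intro S hS
  by_contra h
  refine hS (goodPart_apply_of_not x fun h' => h ⟨h'.1, ?_⟩)
  rw [h'.2]
  push_cast
  rfl

lemma exists_goodPart_eq [Fintype V] {d : ℕ} {y : Finset V → ℤ}
    (hy : y ∈ chainsOn {S | good S} (d + 1)) : ∃ x : Chain V d, goodPart good d x = y := by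
  refine ⟨Finsupp.equivFunOnFinite.symm fun S => y S.1, ?_⟩
  funext S
  by_cases h : good S ∧ S.card = d + 1
  · rw [goodPart_apply _ h.1 h.2]
    rfl
  · rw [goodPart_apply_of_not _ h]
    by_contra h0
    obtain ⟨h1, h2⟩ := hy S (Ne.symm h0)
    exact h ⟨h1, by exact_mod_cast h2⟩

lemma mem_badChains_iff {d : ℕ} (x : Chain V d) :
    x ∈ badChains V good d ↔ goodPart good d x = 0 := by
  have hset : {x : Chain V d | ∃ S : Gen V d, ¬good S.1 ∧ x = Finsupp.single S 1} =
      (fun S => Finsupp.single S (1 : ℤ)) '' {S : Gen V d | ¬good S.1} := by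
    ext y
    constructor
    · rintro ⟨S, hS, rfl⟩
      exact ⟨S, hS, rfl⟩
    · rintro ⟨S, hS, rfl⟩
      exact ⟨S, hS, rfl⟩
  rw [badChains, hset, ← Finsupp.supported_eq_span_single, Finsupp.mem_supported']
  constructor
  · intro h
    funext S
    by_cases hS : good S ∧ S.card = d + 1
    · rw [goodPart_apply _ hS.1 hS.2]
      exact h _ fun h' => h' hS.1
    · exact goodPart_apply_of_not _ hS
  · intro h S hS
    rw [← goodPart_apply x (not_not.1 hS) S.2, h, Pi.zero_apply]

variable [LinearOrder V] [Fintype V]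

lemma bdry_single_apply {d : ℕ} (T : Gen V (d + 1)) (S : Gen V d) :
    (bdry V (d + 1) (Finsupp.single T 1) : Chain V d) S =
      ∑ s, if s ∈ S.1 then 0 else incSign s S.1 * if insert s S.1 = T.1 then 1 else 0 := by
  have hlift : (bdry V (d + 1) (Finsupp.single T 1) : Chain V d) =
      ∑ s ∈ T.1, ((-1 : ℤ) ^ (T.1.filter fun t => t < s).card) •
        (if h : (T.1.erase s).card = d + 1
          then Finsupp.single (⟨T.1.erase s, h⟩ : Gen V d) (1 : ℤ) else 0) := by
    rw [bdry, Finsupp.lift_apply, Finsupp.sum_single_index (by simp), one_smul]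
    rfl
  rw [hlift, Finsupp.finsetSum_apply, ← Finset.sum_filter_add_sum_filter_not Finset.univ
    (fun s => s ∈ T.1), Finset.filter_univ_mem]
  rw [Finset.sum_eq_zero (s := Finset.univ.filter fun s => s ∉ T.1), add_zero]
  · refine Finset.sum_congr rfl fun s hs => ?_
    have hcard : (T.1.erase s).card = d + 1 := by
      rw [Finset.card_erase_of_mem hs, T.2]
      rfl
    rw [dif_pos hcard, Finsupp.smul_apply, smul_eq_mul, Finsupp.single_apply]
    by_cases h : T.1.erase s = S.1
    · have hsS : s ∉ S.1 := h ▸ Finset.notMem_erase s T.1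
      have hins : insert s S.1 = T.1 := by rw [← h, Finset.insert_erase hs]
      rw [if_pos (Subtype.ext h), if_neg hsS, if_pos hins, incSign, ← hins,
        Finset.filter_insert, if_neg (lt_irrefl s)]
    · rw [if_neg fun h' => h (congrArg Subtype.val h'), mul_zero]
      split_ifs with hsS hins
      · rfl
      · exact absurd (by rw [← hins, Finset.erase_insert hsS]) h
      · rw [mul_zero]
  · intro s hs
    have hsT : s ∉ T.1 := (Finset.mem_filter.1 hs).2
    split_ifs with hsS hins
    · rfl
    · exact absurd (hins ▸ Finset.mem_insert_self s S.1) hsT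
    · rw [mul_zero]

lemma goodPart_bdry (hup : ∀ S T, good S → S ⊆ T → good T) {d : ℕ} (x : Chain V (d + 1)) :
    goodPart good d (bdry V (d + 1) x) = bdryOn {S | good S} (goodPart good (d + 1) x) := by
  suffices h : goodPart good d ∘ₗ bdry V (d + 1) =
      bdryOn {S | good S} ∘ₗ goodPart good (d + 1) from LinearMap.congr_fun h x
  refine Finsupp.lhom_ext' fun T => LinearMap.ext_ring (funext fun S => ?_)
  simp only [LinearMap.comp_apply, Finsupp.lsingle_apply]
  by_cases hS : good S ∧ S.card = d + 1
  · rw [goodPart_apply _ hS.1 hS.2, bdryOn_apply_of_mem (F := {S | good S}) hS.1, del_apply]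
    refine (bdry_single_apply T ⟨S, hS.2⟩).trans (Finset.sum_congr rfl fun s _ => ?_)
    split_ifs with hsS hins
    · rfl
    · congr 1
      have hc : (insert s S).card = d + 1 + 1 := by
        rw [Finset.card_insert_of_notMem hsS, hS.2]
      rw [goodPart_apply _ (hup _ _ hS.1 (Finset.subset_insert _ _)) hc, Finsupp.single_apply,
        if_pos (Subtype.ext hins.symm)]
    · congr 1
      have hc : (insert s S).card = d + 1 + 1 := by
        rw [Finset.card_insert_of_notMem hsS, hS.2]
      rw [goodPart_apply _ (hup _ _ hS.1 (Finset.subset_insert _ _)) hc, Finsupp.single_apply,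
        if_neg fun h => hins (congrArg Subtype.val h).symm]
  · rw [goodPart_apply_of_not _ hS]
    by_contra h0
    obtain ⟨h1, h2⟩ := bdryOn_mem (F := {S | good S}) (n := d + 1) (by push_cast; rfl)
      (goodPart_mem_chainsOn (good := good) (Finsupp.single T 1)) S (Ne.symm h0)
    exact hS ⟨h1, by exact_mod_cast h2⟩

lemma mem_cycles_iff (hup : ∀ S T, good S → S ⊆ T → good T) (hempty : ¬good ∅) {d : ℕ}
    (x : Chain V d) :
    x ∈ cycles V good d ↔ goodPart good d x ∈ cyclesOn {S | good S} (d + 1) := by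
  rw [mem_cyclesOn, and_iff_right (goodPart_mem_chainsOn x), cycles, Submodule.mem_comap,
    mem_badChains_iff]
  cases d with
  | succ d => exact iff_of_eq (congrArg (· = 0) (goodPart_bdry hup x))
  | zero =>
    refine iff_of_true ?_ ?_
    · have : bdry V 0 = 0 := by
        refine Finsupp.lhom_ext' fun S => LinearMap.ext_ring ?_
        simp only [bdry, LinearMap.comp_apply, Finsupp.lsingle_apply, Finsupp.lift_apply]
        rw [Finsupp.sum_single_index (by simp)]
        refine (smul_eq_zero_of_right _ (Finset.sum_eq_zero fun s hs => ?_)).trans rfl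
        rw [dif_neg, smul_zero]
        rw [Finset.card_erase_of_mem hs, S.2]
        simp
      rw [this, LinearMap.zero_apply, map_zero]
    · have h := bdryOn_mem (F := {S | good S}) (n := 0) (by simp)
        (goodPart_mem_chainsOn (good := good) x)
      funext S
      by_contra h0
      obtain ⟨h1, h2⟩ := h S h0
      rw [Nat.cast_eq_zero, Finset.card_eq_zero] at h2
      subst h2
      exact hempty h1

lemma mem_boundaries_iff (hup : ∀ S T, good S → S ⊆ T → good T) {d : ℕ} (x : Chain V d) :
    x ∈ badChains V good d ⊔ LinearMap.range (bdry V (d + 1)) ↔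
      goodPart good d x ∈ boundariesOn {S | good S} (d + 1) := by
  rw [Submodule.mem_sup, mem_boundariesOn]
  constructor
  · rintro ⟨y, hy, _, ⟨w, rfl⟩, rfl⟩
    refine ⟨goodPart good (d + 1) w, by exact_mod_cast goodPart_mem_chainsOn w, ?_⟩
    rw [map_add, (mem_badChains_iff y).1 hy, zero_add]
    exact (goodPart_bdry hup w).symm
  · rintro ⟨y, hy, hyx⟩
    obtain ⟨w, rfl⟩ := exists_goodPart_eq (d := d + 1) (by exact_mod_cast hy)
    let u : Chain V d := bdry V (d + 1) w
    refine ⟨x - u, ?_, u, ⟨w, rfl⟩, sub_add_cancel _ _⟩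
    rw [mem_badChains_iff, map_sub, sub_eq_zero, ← hyx]
    exact (goodPart_bdry hup w).symm

lemma subsingleton_homology (hup : ∀ S T, good S → S ⊆ T → good T) (hempty : ¬good ∅) {d : ℕ}
    (h : ExactOn {S | good S} (d + 1)) : Subsingleton (homology V good d) := by
  rw [Submodule.Quotient.subsingleton_iff, eq_top_iff]
  rintro ⟨x, hx⟩ -
  exact (mem_boundaries_iff hup x).2 (h ((mem_cycles_iff hup hempty x).1 hx))

lemma nonempty_homology_equiv (hup : ∀ S T, good S → S ⊆ T → good T) (hempty : ¬good ∅)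
    {d t : ℕ} (h : ConcentratedOn {S | good S} (d + 1) t) :
    Nonempty (homology V good d ≃ₗ[ℤ] (Fin t → ℤ)) := by
  obtain ⟨-, ι, _, z, rfl, hz, hs, hi⟩ := h
  choose w hw using fun i => exists_goodPart_eq (hz i).1
  have hwc : ∀ i, w i ∈ cycles V good d := fun i =>
    (mem_cycles_iff hup hempty _).2 (by rw [hw]; exact hz i)
  let φ : (ι → ℤ) →ₗ[ℤ] homology V good d :=
    Submodule.mkQ _ ∘ₗ Fintype.linearCombination ℤ fun i => (⟨w i, hwc i⟩ : cycles V good d)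
  have hval : ∀ c : ι → ℤ, goodPart good d
      (Fintype.linearCombination ℤ (fun i => (⟨w i, hwc i⟩ : cycles V good d)) c).1 =
      ∑ i, c i • z i := by
    intro c
    rw [Fintype.linearCombination_apply, Submodule.coe_sum, map_sum]
    refine Finset.sum_congr rfl fun i _ => ?_
    rw [Submodule.coe_smul, map_smul, hw]
  have hφ : Function.Bijective φ := by
    constructor
    · rw [injective_iff_map_eq_zero]
      intro c hc
      refine hi c ?_
      rw [← hval]
      have hc' := (Submodule.Quotient.mk_eq_zero _).1 hc
      exact (mem_boundaries_iff hup _).1 hc'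
    · intro q
      obtain ⟨⟨x, hx⟩, rfl⟩ := Submodule.Quotient.mk_surjective _ q
      obtain ⟨c, hc⟩ := hs _ ((mem_cycles_iff hup hempty x).1 hx)
      refine ⟨c, ((Submodule.Quotient.eq _).2 ?_).symm⟩
      rw [← hval, ← map_sub] at hc
      exact (mem_boundaries_iff hup _).2 hc
  exact ⟨(LinearEquiv.ofBijective φ hφ).symm.trans
    (LinearEquiv.funCongrLeft ℤ ℤ (Fintype.equivFin ι).symm)⟩

end Comparison

section GoodConn

variable {m b : ℕ} {A : Fin m → ℕ}

lemma connected_iff_forall_coloring {α : Type*} [Nonempty α] (G : SimpleGraph α) :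
    G.Connected ↔ ∀ c : α → Prop, (∀ x y, G.Adj x y → (c x ↔ c y)) → ∀ x y, c x ↔ c y := by
  constructor
  · intro h c hc x y
    obtain ⟨p⟩ := h.preconnected x y
    induction p with
    | nil => rfl
    | cons hadj _ ih => exact (hc _ _ hadj).trans ih
  · intro h
    refine (SimpleGraph.connected_iff _).2 ⟨fun x y => ?_, inferInstance⟩
    exact (h (fun v => G.Reachable x v) (fun v w hvw =>
      ⟨fun h' => h'.trans hvw.reachable, fun h' => h'.trans hvw.symm.reachable⟩) x y).1
      (SimpleGraph.Reachable.refl x)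

lemma goodConn_iff (hA : ∀ j, 2 ≤ A j) (S : Finset (Vtx m A b)) :
    goodConn m A b S ↔
      S ∈ innerFamily A (Finset.univ.map (Function.Embedding.inr : Fin b ↪ Vtx m A b)) := by
  have hin : ∀ v : Vtx m A b, ¬IsInner A v ↔ ∃ i, v = Sum.inr i := by
    rintro (⟨j, e⟩ | i)
    · simp [IsInner]
    · simp [IsInner]
  have hB : (∀ i : Fin b, (Sum.inr i : Vtx m A b) ∈ S) ↔ ∀ v, ¬IsInner A v →
      (v ∈ S ↔ v ∈ Finset.univ.map (Function.Embedding.inr : Fin b ↪ Vtx m A b)) := by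
    simp [hin]
  rw [goodConn, and_comm]
  refine and_congr hB (forall_congr' fun j => ?_)
  have : Nonempty (Fin (A j)) := ⟨⟨0, by have := hA j; omega⟩⟩
  rw [connected_iff_forall_coloring]
  refine forall_congr' fun c => imp_congr ⟨fun h e he _ => ?_, fun h x y hxy => ?_⟩ (by simp)
  · refine h _ _ ((SimpleGraph.fromEdgeSet_adj _).2 ⟨⟨e, he, rfl⟩, e.2.ne⟩)
  · obtain ⟨⟨e, he, heq⟩, -⟩ := (SimpleGraph.fromEdgeSet_adj _).1 hxy
    have := h e he e.1.2.2
    rcases Sym2.eq_iff.1 heq with ⟨rfl, rfl⟩ | ⟨rfl, rfl⟩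
    · exact this
    · exact this.symm

lemma goodConn_mono {S T : Finset (Vtx m A b)} (hS : goodConn m A b S) (h : S ⊆ T) :
    goodConn m A b T :=
  ⟨fun j => (hS.1 j).mono (SimpleGraph.fromEdgeSet_mono (by
    rintro _ ⟨e, he, hq⟩
    exact ⟨e, h he, hq⟩)), fun i => h (hS.2 i)⟩

lemma not_goodConn_empty (hA : ∀ j, 2 ≤ A j) (hmb : 1 ≤ m + b) : ¬goodConn m A b ∅ := by
  rintro h
  rcases Nat.eq_zero_or_pos b with rfl | hb
  · have hm : 0 < m := by omega
    have h2 := hA ⟨0, hm⟩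
    have := ((goodConn_iff hA _).1 h).2 ⟨0, hm⟩ (fun x => (x : ℕ) = 0) (by simp)
      ⟨0, by omega⟩ ⟨1, by omega⟩ (by simp; omega) (by simp; omega)
    simp at this
  · simpa using h.2 ⟨0, hb⟩

end GoodConn

/-- Let `A = (a₁,…,a_m)` with each `a_j ≥ 2`, `b ≥ 0`,
`m + b ≥ 1`, and `i = |A| − m + b`.  For any linear order on the vertex set,
the homology of the quotient complex vanishes in every degree other than
`i − 1`, and in degree `i − 1` it is free abelian of rank
`(a₁−1)!⋯(a_m−1)!`. -/
theorem homology_connected_collection_complex (m b : ℕ) (A : Fin m → ℕ)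
    (hA : ∀ j, 2 ≤ A j) (hmb : 1 ≤ m + b) [LinearOrder (Vtx m A b)] :
    (∀ d : ℕ, d ≠ (∑ j, A j) - m + b - 1 →
      Subsingleton (homology (Vtx m A b) (goodConn m A b) d)) ∧
    Nonempty (homology (Vtx m A b) (goodConn m A b) ((∑ j, A j) - m + b - 1) ≃ₗ[ℤ]
      (Fin (∏ j, Nat.factorial (A j - 1)) → ℤ)) := by
  have hup : ∀ S T : Finset (Vtx m A b), goodConn m A b S → S ⊆ T → goodConn m A b T :=
    fun _ _ => goodConn_mono
  have hempty : ¬goodConn m A b ∅ := not_goodConn_empty hA hmb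
  have hmain := concentratedOn_innerFamily A (fun j => (Nat.le_succ 1).trans (hA j))
    (fun _ => le_rfl) (Finset.univ.map (Function.Embedding.inr : Fin b ↪ Vtx m A b)) (by
      simp [IsInner])
  have hset : innerFamily A (Finset.univ.map (Function.Embedding.inr : Fin b ↪ Vtx m A b)) =
      {S | goodConn m A b S} := Set.ext fun S => (goodConn_iff hA S).symm
  have hsum : ∑ j, (A j - 1) + m = ∑ j, A j := by
    have : ∑ j, (A j - 1 + 1) = ∑ j, A j :=
      Finset.sum_congr rfl fun j _ => Nat.sub_add_cancel ((Nat.le_succ 1).trans (hA j))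
    simpa [Finset.sum_add_distrib] using this
  have hge : m ≤ ∑ j, (A j - 1) := by
    simpa using Finset.card_nsmul_le_sum Finset.univ (fun j => A j - 1) 1
      fun j _ => Nat.le_sub_of_add_le (hA j)
  rw [hset, Finset.card_map, Finset.card_univ, Fintype.card_fin] at hmain
  have hdeg : b + ∑ j, (A j - 1) = ((∑ j, A j) - m + b - 1) + 1 := by omega
  rw [hdeg] at hmain
  refine ⟨fun d hd => subsingleton_homology hup hempty (hmain.1 _ ?_),
    nonempty_homology_equiv hup hempty (by exact_mod_cast hmain)⟩
  intro h
  exact hd (Nat.succ_injective (by exact_mod_cast h))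

end
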